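/- Let G be a simple graph on n vertices, set r = ⌈n/2⌉, and suppose the Smith normal form of W(G) is diag(1, ..., 1, 2^{l_1}, 2^{l_2}, ..., 2^{l_{n−r−1}}, 2^{l_{n−r}} p_1^{m_1} p_2^{m_2} ··· p_s^{m_s}), with r ones, exponents l_1, ..., l_{n−r} ≥ 1, exponents m_1, ..., m_s ≥ 1, and p_1, ..., p_s distinct odd primes. Then every Q ∈ Q(G) with level ℓ satisfies ℓ | 2^{l_{n−r}−1} p_1^{m_1−1} p_2^{m_2−1} ··· p_s^{m_s−1}. -/

import Mathlib

open Matrix Polynomial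
open scoped Classical

noncomputable section

/-- The adjacency matrix of a simple graph on `Fin n`, with integer entries. -/
def adjMat (n : ℕ) (G : SimpleGraph (Fin n)) : Matrix (Fin n) (Fin n) ℤ :=
  Matrix.of fun i j => if G.Adj i j then 1 else 0

/-- The walk matrix `W = [e, Ae, ..., A^{n-1}e]` of a matrix `A`. -/
def walkMat {n : ℕ} (A : Matrix (Fin n) (Fin n) ℤ) : Matrix (Fin n) (Fin n) ℤ :=
  Matrix.of fun i j => ((A ^ (j : ℕ)) *ᵥ fun _ => (1 : ℤ)) i

/-- Membership in `Q(G)`: `Q` is a regular rational orthogonal matrix such that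
`Qᵀ A Q` is a 0-1 matrix. -/
def inQSet {n : ℕ} (A : Matrix (Fin n) (Fin n) ℤ) (Q : Matrix (Fin n) (Fin n) ℚ) : Prop :=
  Qᵀ * Q = 1 ∧ (Q *ᵥ fun _ => (1 : ℚ)) = (fun _ => 1) ∧
  ∀ i j, (Qᵀ * A.map (Int.cast : ℤ → ℚ) * Q) i j = 0 ∨
         (Qᵀ * A.map (Int.cast : ℤ → ℚ) * Q) i j = 1

/-- `ℓ` is the level of the rational matrix `Q`: the smallest positive integer `k`
such that `k • Q` is an integral matrix. -/
def IsLevel {n : ℕ} (Q : Matrix (Fin n) (Fin n) ℚ) (ℓ : ℕ) : Prop :=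
  0 < ℓ ∧ (∀ i j, ∃ z : ℤ, (ℓ : ℚ) * Q i j = z) ∧
  ∀ k : ℕ, 0 < k → (∀ i j, ∃ z : ℤ, (k : ℚ) * Q i j = z) → ℓ ≤ k

/-- A square integral matrix is unimodular if its determinant is a unit (i.e. `±1`). -/
def IsUnimodular {n : ℕ} (U : Matrix (Fin n) (Fin n) ℤ) : Prop :=
  IsUnit U.det

/-- `diag d` is the Smith normal form of `W`: `W = U (diag d) V` with `U, V` unimodular
and `d_i ∣ d_{i+1}`. -/
def IsSNF {n : ℕ} (W : Matrix (Fin n) (Fin n) ℤ) (d : Fin n → ℤ) : Prop :=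
  (∃ U V : Matrix (Fin n) (Fin n) ℤ, IsUnimodular U ∧ IsUnimodular V ∧
    W = U * Matrix.diagonal d * V) ∧
  ∀ i j : Fin n, i ≤ j → d i ∣ d j



/-- `f(A) e`. -/
def wk {R : Type*} [CommRing R] {n : ℕ} (A : Matrix (Fin n) (Fin n) R) (f : R[X]) : Fin n → R :=
  (aeval A f) *ᵥ (fun _ => (1 : R))

section Basic
variable {R : Type*} [CommRing R] {n : ℕ} (A : Matrix (Fin n) (Fin n) R)

lemma wk_mul (f g : R[X]) : wk A (f * g) = (aeval A f) *ᵥ wk A g := by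
  simp [wk, Matrix.mulVec_mulVec]

lemma wk_add (f g : R[X]) : wk A (f + g) = wk A f + wk A g := by
  simp [wk, Matrix.add_mulVec]

lemma wk_mul_zero (f g : R[X]) (h : wk A g = 0) : wk A (f * g) = 0 := by
  rw [wk_mul, h, Matrix.mulVec_zero]

lemma wk_dvd_zero (f g : R[X]) (h : wk A g = 0) (hd : g ∣ f) : wk A f = 0 := by
  obtain ⟨k, rfl⟩ := hd
  rw [mul_comm]; exact wk_mul_zero A _ _ h

/-- The linear map `f ↦ f(A) e`. -/
def wkL : R[X] →ₗ[R] (Fin n → R) where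
  toFun := wk A
  map_add' := wk_add A
  map_smul' c f := by simp [wk, Matrix.smul_mulVec]

@[simp] lemma wkL_apply (f : R[X]) : wkL A f = wk A f := rfl

lemma wk_charpoly : wk A A.charpoly = 0 := by
  simp [wk, Matrix.aeval_self_charpoly]

lemma aeval_transpose_symm (hA : Aᵀ = A) (f : R[X]) : (aeval A f)ᵀ = aeval A f := by
  induction f using Polynomial.induction_on' with
  | add p q hp hq => simp [hp, hq]
  | monomial k a => simp [aeval_monomial, Algebra.algebraMap_eq_smul_one, Matrix.transpose_pow, hA]

/-- generic walk matrix -/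
def wM : Matrix (Fin n) (Fin n) R := Matrix.of fun i j => wk A (X ^ (j : ℕ)) i

lemma wM_mulVec (c : Fin n → R) : wM A *ᵥ c = wk A (∑ j : Fin n, C (c j) * X ^ (j : ℕ)) := by
  rw [← wkL_apply, map_sum]
  ext i
  simp only [Matrix.mulVec, dotProduct, wM, Matrix.of_apply, Finset.sum_apply]
  refine Finset.sum_congr rfl fun j _ => ?_
  rw [← smul_eq_C_mul, map_smul]
  simp [mul_comm]

lemma wM_gram (hA : Aᵀ = A) (i j : Fin n) :
    ((wM A)ᵀ * wM A) i j = (fun _ => (1 : R)) ⬝ᵥ wk A (X ^ (i : ℕ) * X ^ (j : ℕ)) := by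
  have : ((wM A)ᵀ * wM A) i j = wk A (X ^ (i : ℕ)) ⬝ᵥ wk A (X ^ (j : ℕ)) := rfl
  rw [this, wk_mul, Matrix.dotProduct_mulVec, ← Matrix.mulVec_transpose,
    aeval_transpose_symm A hA]
  rfl

end Basic

section FieldPart
variable {F : Type*} [Field F] {n : ℕ} (A B : Matrix (Fin n) (Fin n) F)

lemma range_wkL_le (f : F[X]) (hf : f ≠ 0) (h : wk A f = 0) :
    Module.finrank F (LinearMap.range (wkL A)) ≤ f.natDegree := by
  have h1 : LinearMap.range (wkL A) ≤
      LinearMap.range ((wkL A).comp (degreeLT F f.natDegree).subtype) := by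
    rintro _ ⟨g, rfl⟩
    have hm : g % f ∈ degreeLT F f.natDegree := by
      rw [mem_degreeLT, ← degree_eq_natDegree hf]
      exact EuclideanDomain.mod_lt g hf
    refine ⟨⟨g % f, hm⟩, ?_⟩
    have h2 := EuclideanDomain.div_add_mod g f
    have h3 : wk A g = wk A (g % f) := by
      conv_lhs => rw [← h2]
      rw [wk_add, wk_dvd_zero A _ f h (dvd_mul_right _ _), zero_add]
    simp [h3]
  have h4 : Module.Finite F (degreeLT F f.natDegree) :=
    Module.Finite.equiv (degreeLTEquiv F f.natDegree).symm
  refine (Submodule.finrank_mono h1).trans ((LinearMap.finrank_range_le _).trans ?_)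
  rw [(degreeLTEquiv F f.natDegree).finrank_eq]
  simp

lemma dvd_of_wk (ψ f : F[X]) (hψ : ψ ≠ 0) (h0 : wk A ψ = 0)
    (hr : ψ.natDegree ≤ Module.finrank F (LinearMap.range (wkL A))) (h : wk A f = 0) : ψ ∣ f := by
  rw [← EuclideanDomain.mod_eq_zero]
  by_contra hne
  have h2 := EuclideanDomain.div_add_mod f ψ
  have h3 : wk A (f % ψ) = 0 := by
    rw [← h2, wk_add, wk_dvd_zero A _ ψ h0 (dvd_mul_right _ _), zero_add] at h
    exact h
  have h4 := range_wkL_le A _ hne h3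
  have h5 : (f % ψ).natDegree < ψ.natDegree :=
    natDegree_lt_natDegree hne (EuclideanDomain.mod_lt f hψ)
  omega

lemma range_wkL_eq : LinearMap.range (wkL A) = LinearMap.range (wM A).mulVecLin := by
  apply le_antisymm
  · rintro _ ⟨g, rfl⟩
    have h2 := EuclideanDomain.div_add_mod g A.charpoly
    have hne : A.charpoly ≠ 0 := A.charpoly_monic.ne_zero
    have h3 : wk A g = wk A (g % A.charpoly) := by
      conv_lhs => rw [← h2]
      rw [wk_add, wk_dvd_zero A _ A.charpoly (wk_charpoly A) (dvd_mul_right _ _), zero_add]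
    have hlt : (g % A.charpoly).degree < n := by
      have : (g % A.charpoly).degree < A.charpoly.degree := EuclideanDomain.mod_lt g hne
      rw [show A.charpoly.degree = n by simp [Matrix.charpoly_degree_eq_dim]] at this
      exact this
    refine ⟨fun j => (g % A.charpoly).coeff j, ?_⟩
    rw [Matrix.mulVecLin_apply, wM_mulVec, wkL_apply, h3]
    congr 1
    by_cases h0 : g % A.charpoly = 0
    · simp [h0]
    conv_rhs => rw [as_sum_range_C_mul_X_pow' (g % A.charpoly) ((natDegree_lt_iff_degree_lt h0).2 hlt)]
    rw [Finset.sum_range]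
  · rintro _ ⟨c, rfl⟩
    exact ⟨_, (wM_mulVec A c).symm⟩

lemma finrank_range_wkL : Module.finrank F (LinearMap.range (wkL A)) = (wM A).rank := by
  rw [range_wkL_eq]; rfl

end FieldPart

section CP
open Module.Basis
variable {R V : Type*} [Field R] [AddCommGroup V] [Module R V] [Module.Finite R V]
    (W : Submodule R V)

theorem my_charpoly_mul (e : V →ₗ[R] V) (he : W ≤ W.comap e) :
    e.charpoly = (e.restrict he).charpoly * (W.mapQ W e he).charpoly := by
  let m := Module.Free.ChooseBasisIndex R W
  let bW : Module.Basis m R W := Module.Free.chooseBasis R W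
  let n := Module.Free.ChooseBasisIndex R (V ⧸ W)
  let bQ : Module.Basis n R (V ⧸ W) := Module.Free.chooseBasis R (V ⧸ W)
  let b := sumQuot bW bQ
  let A : Matrix m m R := LinearMap.toMatrix bW bW (e.restrict he)
  let B : Matrix m n R := Matrix.of fun i l ↦
    ((sumQuot bW bQ).repr (e ((sumQuot bW bQ) (Sum.inr l)))) (Sum.inl i)
  let D : Matrix n n R := LinearMap.toMatrix bQ bQ (W.mapQ W e he)
  suffices LinearMap.toMatrix b b e = Matrix.fromBlocks A B 0 D by
    rw [← LinearMap.charpoly_toMatrix e b, this, ← LinearMap.charpoly_toMatrix _ bW,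
      ← LinearMap.charpoly_toMatrix _ bQ, Matrix.charpoly_fromBlocks_zero₂₁]
  ext u v
  cases u with
  | inl i =>
    cases v with
    | inl k =>
      simp only [b, sumQuot_inl, Matrix.fromBlocks_apply₁₁, A, LinearMap.toMatrix_apply]
      apply sumQuot_repr_inl_of_mem
    | inr l => simp [b, LinearMap.toMatrix_apply, Matrix.fromBlocks_apply₁₂, B]
  | inr j =>
    cases v with
    | inl k =>
      suffices W.mkQ (e (bW k)) = 0 by simp [LinearMap.toMatrix_apply, b, this]
      rw [← LinearMap.mem_ker, Submodule.ker_mkQ]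
      exact he (Submodule.coe_mem (bW k))
    | inr l =>
      simp only [LinearMap.toMatrix_apply, sumQuot_repr_inr,
        Matrix.fromBlocks_apply₂₂, b, D]
      rw [← sumQuot_inr bW bQ l, W.mapQ_apply]
      simp

end CP

section FieldPart2
variable {F : Type*} [Field F] {n : ℕ} (A B : Matrix (Fin n) (Fin n) F)

/-- Structure when the walk matrix has corank one. -/
lemma corank_one (hA : Aᵀ = A) (hn : 0 < n) (hr : (wM A).rank = n - 1) :
    ∃ (μ : F[X]) (a : F), μ.Monic ∧ μ.natDegree = n - 1 ∧ wk A μ = 0 ∧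
      A.charpoly = μ * (X - C a) ∧
      ∀ u : Fin n → F, (∀ f, u ⬝ᵥ wk A f = 0) → A *ᵥ u = a • u := by
  set W := LinearMap.range (wkL A) with hW
  have hfr : Module.finrank F W = n - 1 := by rw [hW, finrank_range_wkL, hr]
  have he : W ≤ W.comap A.mulVecLin := by
    rintro _ ⟨f, rfl⟩
    refine ⟨X * f, ?_⟩
    simp [wk_mul]
  have hcp := my_charpoly_mul W A.mulVecLin he
  rw [Matrix.charpoly_mulVecLin] at hcp
  set μ := (A.mulVecLin.restrict he).charpoly with hμ
  set κ := (W.mapQ W A.mulVecLin he).charpoly with hκ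
  have hκm : κ.Monic := LinearMap.charpoly_monic _
  have hκd : κ.natDegree = 1 := by
    rw [hκ, LinearMap.charpoly_natDegree]
    have := Submodule.finrank_quotient_add_finrank W
    rw [hfr, Module.finrank_fin_fun] at this
    omega
  have hκe : κ = X - C (-κ.coeff 0) := by
    rw [hκm.eq_X_add_C hκd]; simp
  have hpow : ∀ (f : F[X]) (w : W), (((aeval (A.mulVecLin.restrict he)) f w : W) : Fin n → F)
      = (aeval A f) *ᵥ (w : Fin n → F) := by
    intro f w
    induction f using Polynomial.induction_on' with
    | add p q hp hq => simp [hp, hq, Matrix.add_mulVec]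
    | monomial k c =>
      have : ∀ k : ℕ, ((((A.mulVecLin.restrict he) ^ k) w : W) : Fin n → F)
          = (A ^ k) *ᵥ (w : Fin n → F) := by
        intro k
        induction k with
        | zero => simp
        | succ k ih =>
          rw [pow_succ', pow_succ', Module.End.mul_apply, ← Matrix.mulVec_mulVec, ← ih]
          rfl
      simp [aeval_monomial, Algebra.algebraMap_eq_smul_one, this, Matrix.smul_mulVec]
  refine ⟨μ, -κ.coeff 0, LinearMap.charpoly_monic _, ?_, ?_, ?_, ?_⟩
  · rw [hμ, LinearMap.charpoly_natDegree, hfr]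
  · have h1 : wk A 1 ∈ W := ⟨1, rfl⟩
    have h2 := hpow μ ⟨wk A 1, h1⟩
    rw [hμ, LinearMap.aeval_self_charpoly] at h2
    have h3 : wk A (μ * 1) = _ := wk_mul A μ 1
    rw [mul_one] at h3
    rw [h3]
    simpa using h2.symm
  · rw [hcp, ← hκe]
  · intro u hu
    set a := -κ.coeff 0 with ha
    have h1 : aeval (W.mapQ W A.mulVecLin he) κ = 0 := LinearMap.aeval_self_charpoly _
    have h2 : ∀ v : Fin n → F, A *ᵥ v - a • v ∈ W := by
      intro v
      rw [hκe] at h1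
      have h3 := LinearMap.congr_fun h1 (W.mkQ v)
      simp only [map_sub, aeval_X, aeval_C, LinearMap.sub_apply, LinearMap.zero_apply,
        Module.algebraMap_end_apply] at h3
      rw [← Submodule.Quotient.mk_eq_zero]
      exact h3
    have h3 : ∀ v : Fin n → F, (A *ᵥ u - a • u) ⬝ᵥ v = 0 := by
      intro v
      obtain ⟨f, hf⟩ := h2 v
      have h4 := hu f
      rw [← wkL_apply, hf, dotProduct_sub, Matrix.dotProduct_mulVec, ← Matrix.mulVec_transpose,
        hA] at h4
      rw [sub_dotProduct, smul_dotProduct]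
      rwa [dotProduct_smul] at h4
    exact sub_eq_zero.1 (dotProduct_eq_zero _ h3)

lemma main_odd (hA : Aᵀ = A) (hB : Bᵀ = B) (hn : 0 < n) (hr : (wM A).rank = n - 1)
    (hτ : ∀ f, (fun _ => (1 : F)) ⬝ᵥ wk A f = (fun _ => (1 : F)) ⬝ᵥ wk B f)
    (hχ : A.charpoly = B.charpoly) (f : F[X]) (hf : wk A f = 0) : wk B f = 0 := by
  obtain ⟨μ, a, hμm, hμd, hμ0, hχμ, hperp⟩ := corank_one A hA hn hr
  have hdv : ∀ g, wk A g = 0 → μ ∣ g := fun g hg =>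
    dvd_of_wk A μ g hμm.ne_zero hμ0 (by rw [finrank_range_wkL, hr, hμd]) hg
  refine wk_dvd_zero B f μ ?_ (hdv f hf)
  -- the annihilator ideal of `e` for `B`
  let I : Ideal F[X] :=
    { carrier := {g | wk B g = 0}
      add_mem' := fun {x y} hx hy => by
        simp only [Set.mem_ofPred_eq] at *; rw [wk_add, hx, hy, add_zero]
      zero_mem' := by simp [wk]
      smul_mem' := fun c x hx => wk_mul_zero B c x hx }
  have hI : ∀ g, g ∈ I ↔ wk B g = 0 := fun g => Iff.rfl
  obtain ⟨ν, hν⟩ := (IsPrincipalIdealRing.principal I).principal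
  have hνd : ∀ g, wk B g = 0 ↔ ν ∣ g := by
    intro g
    rw [← hI, hν]
    exact Ideal.mem_span_singleton
  have hν0 : wk B ν = 0 := (hνd ν).2 dvd_rfl
  -- the walk matrix of `B` is singular
  have hdetA : (wM A).det = 0 := by
    by_contra h
    have := Matrix.rank_of_isUnit (wM A) ((Matrix.isUnit_iff_isUnit_det _).2 (isUnit_iff_ne_zero.2 h))
    rw [hr, Fintype.card_fin] at this
    omega
  have hdetB : (wM B).det = 0 := by
    have h1 : (wM B)ᵀ * wM B = (wM A)ᵀ * wM A := by
      ext i j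
      rw [wM_gram A hA, wM_gram B hB, hτ]
    have h2 := congrArg Matrix.det h1
    rw [Matrix.det_mul, Matrix.det_mul, hdetA, mul_zero, Matrix.det_transpose] at h2
    exact mul_self_eq_zero.1 h2
  obtain ⟨c, hc0, hc⟩ := Matrix.exists_mulVec_eq_zero_iff.2 hdetB
  rw [wM_mulVec] at hc
  set g0 : F[X] := ∑ j : Fin n, C (c j) * X ^ (j : ℕ) with hg0
  have hg0ne : g0 ≠ 0 := by
    intro h
    apply hc0
    ext i
    have := congrArg (fun q => coeff q (i : ℕ)) h
    simpa [hg0, finsetSum_coeff, coeff_C_mul, coeff_X_pow, Fin.val_inj] using this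
  have hg0d : g0.degree < n := by
    rw [hg0]
    exact degree_sum_fin_lt c
  have hνdeg : ν.natDegree ≤ n - 1 := by
    have h1 := natDegree_le_of_dvd ((hνd g0).1 hc) hg0ne
    have h2 := (natDegree_lt_iff_degree_lt hg0ne).2 hg0d
    omega
  rw [hνd]
  by_contra hnd
  have hpr : Irreducible (X - C a) := irreducible_X_sub_C a
  have hνχ : ν ∣ μ * (X - C a) := by
    rw [← hχμ, hχ, ← hνd]; exact wk_charpoly B
  have hXν : (X - C a) ∣ ν := by
    by_contra h
    exact hnd ((((hpr.coprime_iff_not_dvd).2 h).symm).dvd_of_dvd_mul_right hνχ)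
  obtain ⟨g, hg⟩ := hXν
  have hXne : (X - C a) ≠ 0 := X_sub_C_ne_zero a
  have hgμ : g ∣ μ := by
    rw [hg, mul_comm μ] at hνχ
    exact (mul_dvd_mul_iff_left hXne).1 hνχ
  obtain ⟨h, hh⟩ := hgμ
  have hXh : ¬ (X - C a) ∣ h := by
    rintro ⟨k, rfl⟩
    exact hnd ⟨k, by rw [hh, hg]; ring⟩
  have hcop : IsCoprime (X - C a) h := (hpr.coprime_iff_not_dvd).2 hXh
  have hperpg : ∀ k, wk A g ⬝ᵥ wk A k = 0 := by
    intro k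
    have h1 : wk A g ⬝ᵥ wk A k = (fun _ => (1 : F)) ⬝ᵥ wk A (g * k) := by
      rw [wk_mul, Matrix.dotProduct_mulVec, ← Matrix.mulVec_transpose, aeval_transpose_symm A hA]
      rfl
    obtain ⟨x, y, hxy⟩ := hcop
    have h2 : g * k = (x * k) * ν + (y * k) * μ := by
      rw [hh, hg]; linear_combination (- g * k) * hxy
    rw [h1, h2, wk_add, wk_mul_zero A _ μ hμ0, add_zero, hτ, wk_mul_zero B _ ν hν0, dotProduct_zero]
  have hAg := hperp _ hperpg
  have h5 : wk A ((X - C a) * g) = 0 := by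
    rw [wk_mul]
    simp [Matrix.sub_mulVec, hAg, Algebra.algebraMap_eq_smul_one, Matrix.smul_mulVec]
  have h6 := hdv _ h5
  have hgne : g ≠ 0 := by
    rintro rfl; rw [zero_mul] at hh; exact hμm.ne_zero hh
  rw [hh, mul_comm (X - C a)] at h6
  have h7 : h ∣ X - C a := (mul_dvd_mul_iff_left hgne).1 h6
  have h8 : IsUnit h := hcop.symm.isUnit_of_dvd' dvd_rfl h7
  have hhne : h ≠ 0 := h8.ne_zero
  have h9 : μ.natDegree = g.natDegree := by
    rw [hh, natDegree_mul hgne hhne, natDegree_eq_zero_of_isUnit h8, add_zero]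
  have h10 : ν.natDegree = 1 + g.natDegree := by
    rw [hg, natDegree_mul hXne hgne, natDegree_X_sub_C]
  omega

end FieldPart2

section ModTwo
variable {n : ℕ}

lemma charpoly_neg_comp (M : Matrix (Fin n) (Fin n) ℤ) :
    (-M).charpoly = (-1) ^ n * M.charpoly.comp (-X) := by
  have h1 : M.charpoly.comp (-X) = (-(-M).charmatrix).det := by
    rw [Matrix.charpoly, ← Polynomial.coe_compRingHom_apply, RingHom.map_det]
    congr 1
    ext1 i j
    by_cases h : i = j
    · subst h
      simp [Matrix.charmatrix_apply]
      ring
    · simp [Matrix.charmatrix_apply, h]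
  rw [h1, Matrix.det_neg, ← mul_assoc, ← pow_add, Fintype.card_fin, ← two_mul, pow_mul]
  simp [Matrix.charpoly]

lemma charpoly_coeff_skew (S : Matrix (Fin n) (Fin n) ℤ) (hS : Sᵀ = -S) (k : ℕ)
    (hk : Odd (n + k)) : S.charpoly.coeff k = 0 := by
  have h1 := charpoly_neg_comp S
  rw [← hS, Matrix.charpoly_transpose] at h1
  have h2 := congrArg (fun q => coeff q k) h1
  have h3 : ((-1 : ℤ[X]) ^ n) = C ((-1) ^ n) := by simp
  have h4 : (-X : ℤ[X]) = C (-1) * X := by simp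
  simp only [h3, coeff_C_mul] at h2
  rw [h4, comp_C_mul_X_coeff, mul_comm (S.charpoly.coeff k)] at h2
  rw [← mul_assoc, ← pow_add, hk.neg_one_pow] at h2
  linarith

/-- `ψ` with `χ ∣ ψ^2` mod 2. -/
lemma exists_psi (A : Matrix (Fin n) (Fin n) ℤ) (hA : Aᵀ = A) (hd : ∀ i, A i i = 0) :
    ∃ ψ : (ZMod 2)[X], ψ.Monic ∧ ψ.natDegree = (n + 1) / 2 ∧
      (A.map (Int.castRingHom (ZMod 2))).charpoly ∣ ψ * ψ := by
  let S : Matrix (Fin n) (Fin n) ℤ := Matrix.of fun i j => if i < j then A i j else - A i j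
  have hS : Sᵀ = -S := by
    ext i j
    have h := congrFun (congrFun hA i) j
    simp only [Matrix.transpose_apply] at h
    rcases lt_trichotomy i j with h1 | h1 | h1
    · simp [S, h1, h1.not_gt, h]
    · subst h1; simp [S, hd]
    · simp [S, h1, h1.not_gt, h]
  have hSA : S.map (Int.castRingHom (ZMod 2)) = A.map (Int.castRingHom (ZMod 2)) := by
    ext i j
    simp only [Matrix.map_apply, S, Matrix.of_apply]
    split_ifs
    · rfl
    · simp [ZMod.neg_eq_self_mod_two]
  set χ := (A.map (Int.castRingHom (ZMod 2))).charpoly with hχ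
  have hχm : χ.Monic := Matrix.charpoly_monic _
  have hχd : χ.natDegree = n := by rw [hχ, Matrix.charpoly_natDegree_eq_dim, Fintype.card_fin]
  have hχc : ∀ k, Odd (n + k) → χ.coeff k = 0 := by
    intro k hk
    rw [hχ, ← hSA, Matrix.charpoly_map, coeff_map, charpoly_coeff_skew S hS k hk, map_zero]
  have key : ∀ f : (ZMod 2)[X], f.Monic → (∀ k, Odd k → f.coeff k = 0) → f.natDegree = 2 * ((n + 1) / 2) →
      χ ∣ f → ∃ ψ : (ZMod 2)[X], ψ.Monic ∧ ψ.natDegree = (n + 1) / 2 ∧ χ ∣ ψ * ψ := by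
    intro f hf hc hdeg hdvd
    have hder : derivative f = 0 := by
      ext k
      rw [coeff_derivative, coeff_zero]
      rcases Nat.even_or_odd (k + 1) with h | h
      · have : ((k : ZMod 2) + 1) = 0 := by
          have := (ZMod.natCast_eq_zero_iff_even (n := k + 1)).2 h
          exact_mod_cast this
        rw [this, mul_zero]
      · rw [hc _ h, zero_mul]
    have h1 := expand_contract 2 hder (by norm_num)
    rw [ZMod.expand_card] at h1
    refine ⟨contract 2 f, ?_, ?_, ?_⟩
    · have h2 := hf.leadingCoeff
      rw [← h1, leadingCoeff_pow] at h2
      rw [Monic]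
      generalize (contract 2 f).leadingCoeff = x at h2
      revert h2; revert x; decide
    · have := natDegree_pow (contract 2 f) 2
      rw [h1, hdeg] at this
      omega
    · rw [← sq, h1]; exact hdvd
  rcases Nat.even_or_odd n with hn | hn
  · refine key χ hχm (fun k hk => hχc k (hn.add_odd hk)) ?_ dvd_rfl
    rw [hχd]; obtain ⟨m, rfl⟩ := hn; omega
  · refine key (X * χ) (monic_X.mul hχm) ?_ ?_ (dvd_mul_left _ _)
    · intro k hk
      obtain ⟨j, rfl⟩ : ∃ j, k = j + 1 := ⟨k - 1, by have := hk.pos; omega⟩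
      rw [coeff_X_mul]
      apply hχc
      obtain ⟨a, ha⟩ := hn; obtain ⟨b, hb⟩ := hk
      exact ⟨a + b, by omega⟩
    · rw [natDegree_X_mul hχm.ne_zero, hχd]; obtain ⟨m, rfl⟩ := hn; omega

lemma wk_psi (A : Matrix (Fin n) (Fin n) (ZMod 2)) (hA : Aᵀ = A) (ψ : (ZMod 2)[X])
    (h : A.charpoly ∣ ψ * ψ) : wk A ψ = 0 := by
  set M := aeval A ψ with hM
  have h1 : M * Mᵀ = 0 := by
    rw [hM, aeval_transpose_symm A hA, ← map_mul]
    obtain ⟨k, hk⟩ := h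
    rw [hk, map_mul, Matrix.aeval_self_charpoly, zero_mul]
  ext i
  have h2 := congrFun (congrFun h1 i) i
  simp only [Matrix.mul_apply, Matrix.transpose_apply, Matrix.zero_apply] at h2
  simp only [wk, Matrix.mulVec, dotProduct, mul_one, Pi.zero_apply, ← hM]
  rw [← h2]
  refine Finset.sum_congr rfl fun j _ => ?_
  generalize M i j = x
  revert x; decide

lemma main_two (A B : Matrix (Fin n) (Fin n) ℤ) (hA : Aᵀ = A) (hB : Bᵀ = B) (hd : ∀ i, A i i = 0)
    (hχ : A.charpoly = B.charpoly)
    (hr : (wM (A.map (Int.castRingHom (ZMod 2)))).rank = (n + 1) / 2)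
    (f : (ZMod 2)[X]) (hf : wk (A.map (Int.castRingHom (ZMod 2))) f = 0) :
    wk (B.map (Int.castRingHom (ZMod 2))) f = 0 := by
  obtain ⟨ψ, hm, hdeg, hdvd⟩ := exists_psi A hA hd
  have h1 := wk_psi (A.map (Int.castRingHom (ZMod 2))) (by rw [← Matrix.transpose_map, hA]) ψ hdvd
  have h2 := wk_psi (B.map (Int.castRingHom (ZMod 2))) (by rw [← Matrix.transpose_map, hB]) ψ
    (by rw [Matrix.charpoly_map, ← hχ, ← Matrix.charpoly_map]; exact hdvd)
  exact wk_dvd_zero _ _ _ h2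
    (dvd_of_wk _ ψ f hm.ne_zero h1 (by rw [finrank_range_wkL, hr, hdeg]) hf)

end ModTwo

section Glue
variable {n : ℕ}

lemma aeval_map_mat {R S : Type*} [CommRing R] [CommRing S] (φ : R →+* S)
    (A : Matrix (Fin n) (Fin n) R) (f : R[X]) :
    aeval (A.map φ) (f.map φ) = (aeval A f).map φ := by
  induction f using Polynomial.induction_on' with
  | add p q hp hq =>
    rw [Polynomial.map_add, map_add, map_add, hp, hq, Matrix.map_add φ (map_add φ)]
  | monomial k a =>
    rw [Polynomial.map_monomial, aeval_monomial, aeval_monomial, Matrix.map_mul,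
      Algebra.algebraMap_eq_smul_one, Algebra.algebraMap_eq_smul_one, ← RingHom.mapMatrix_apply φ (A ^ k),
      map_pow, RingHom.mapMatrix_apply]
    congr 1
    ext i j
    simp [Matrix.one_apply, apply_ite φ]

lemma wk_map {R S : Type*} [CommRing R] [CommRing S] (φ : R →+* S)
    (A : Matrix (Fin n) (Fin n) R) (f : R[X]) :
    wk (A.map φ) (f.map φ) = φ ∘ wk A f := by
  ext i
  simp [wk, aeval_map_mat, Matrix.mulVec, dotProduct]

lemma wM_map {R S : Type*} [CommRing R] [CommRing S] (φ : R →+* S)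
    (A : Matrix (Fin n) (Fin n) R) : wM (A.map φ) = (wM A).map φ := by
  ext i j
  have := congrFun (wk_map φ A (X ^ (j : ℕ))) i
  simpa [wM] using this

lemma walkMat_eq (A : Matrix (Fin n) (Fin n) ℤ) : walkMat A = wM A := by
  ext i j
  simp [walkMat, wM, wk]

lemma solve_snf (W U V : Matrix (Fin n) (Fin n) ℤ) (d : Fin n → ℤ) (hU : IsUnimodular U)
    (hV : IsUnimodular V) (hW : W = U * Matrix.diagonal d * V) (D : ℤ) (hD : ∀ i, d i ∣ D)
    (v : Fin n → ℤ) : ∃ c, W *ᵥ c = D • v := by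
  choose k hk using hD
  refine ⟨V⁻¹ *ᵥ (fun i => k i * (U⁻¹ *ᵥ v) i), ?_⟩
  rw [hW, Matrix.mulVec_mulVec, Matrix.mul_assoc, Matrix.mul_nonsing_inv V hV, Matrix.mul_one,
    ← Matrix.mulVec_mulVec]
  have : (Matrix.diagonal d *ᵥ fun i => k i * (U⁻¹ *ᵥ v) i) = D • (U⁻¹ *ᵥ v) := by
    ext i
    rw [Matrix.mulVec_diagonal, Pi.smul_apply, hk i, smul_eq_mul]
    ring
  rw [this, Matrix.mulVec_smul, Matrix.mulVec_mulVec, Matrix.mul_nonsing_inv U hU, Matrix.one_mulVec]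

lemma step_prime (A B : Matrix (Fin n) (Fin n) ℤ) (Q : Matrix (Fin n) (Fin n) ℚ)
    (hAB : ∀ f : ℤ[X], Qᵀ *ᵥ (fun i => ((wk A f i : ℤ) : ℚ)) = fun i => ((wk B f i : ℤ) : ℚ))
    (p : ℕ) (hp : p.Prime) (t : ℤ)
    (hs : ∀ v : Fin n → ℤ, ∃ c, wM A *ᵥ c = ((p : ℤ) * t) • v)
    (hker : ∀ f : (ZMod p)[X], wk (A.map (Int.castRingHom (ZMod p))) f = 0 →
      wk (B.map (Int.castRingHom (ZMod p))) f = 0) (i j : Fin n) :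
    ∃ z : ℤ, (t : ℚ) * Q i j = z := by
  obtain ⟨c, hc⟩ := hs (Pi.single i 1)
  rw [wM_mulVec] at hc
  set f : ℤ[X] := ∑ j : Fin n, C (c j) * X ^ (j : ℕ) with hf
  have h1 : wk (A.map (Int.castRingHom (ZMod p))) (f.map (Int.castRingHom (ZMod p))) = 0 := by
    rw [wk_map, hc]
    ext k
    simp
  have h2 := hker _ h1
  rw [wk_map] at h2
  have h3 := congrFun h2 j
  simp only [Function.comp_apply, Pi.zero_apply, eq_intCast] at h3
  rw [ZMod.intCast_zmod_eq_zero_iff_dvd _ p] at h3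
  obtain ⟨z, hz⟩ := h3
  have h4 := congrFun (hAB f) j
  rw [hc, hz] at h4
  have h5 : (Qᵀ *ᵥ fun k => (((((p : ℤ) * t) • (Pi.single i 1 : Fin n → ℤ)) k : ℤ) : ℚ)) j
      = (p : ℚ) * t * Q i j := by
    simp only [Matrix.mulVec, dotProduct, Matrix.transpose_apply, Pi.smul_apply, smul_eq_mul]
    rw [Finset.sum_eq_single i]
    · simp; ring
    · intro b _ hb; simp [hb]
    · simp
  rw [h5] at h4
  refine ⟨z, ?_⟩
  have hp0 : (p : ℚ) ≠ 0 := by exact_mod_cast hp.ne_zero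
  push_cast at h4
  apply mul_left_cancel₀ hp0
  linarith

lemma level_dvd (Q : Matrix (Fin n) (Fin n) ℚ) (ℓ : ℕ) (h : IsLevel Q ℓ) (t : ℤ)
    (ht : ∀ i j, ∃ z : ℤ, (t : ℚ) * Q i j = z) : (ℓ : ℤ) ∣ t := by
  obtain ⟨h0, h1, h2⟩ := h
  have hl : (0 : ℤ) < ℓ := by exact_mod_cast h0
  rw [Int.dvd_iff_emod_eq_zero]
  by_contra hne
  have h3 := Int.emod_nonneg t hl.ne'
  have h4 := Int.emod_lt_of_pos t hl
  obtain ⟨k, hk⟩ := Int.eq_ofNat_of_zero_le h3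
  have h5 : 0 < k := by omega
  have := h2 k h5 (by
    intro i j
    obtain ⟨a, ha⟩ := ht i j
    obtain ⟨b, hb⟩ := h1 i j
    refine ⟨a - (t / ℓ) * b, ?_⟩
    have h6 : (k : ℤ) = t - ℓ * (t / ℓ) := by rw [← hk, Int.emod_def]
    have h7 : (k : ℚ) = t - ℓ * ((t / ℓ : ℤ) : ℚ) := by exact_mod_cast h6
    rw [h7]; push_cast
    rw [← ha, ← hb]; ring)
  omega

lemma exists_B (A : Matrix (Fin n) (Fin n) ℤ) (hA : Aᵀ = A) (Q : Matrix (Fin n) (Fin n) ℚ)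
    (hQ : inQSet A Q) : ∃ B : Matrix (Fin n) (Fin n) ℤ, Bᵀ = B ∧ A.charpoly = B.charpoly ∧
      (∀ f : ℤ[X], Qᵀ *ᵥ (fun i => ((wk A f i : ℤ) : ℚ)) = fun i => ((wk B f i : ℤ) : ℚ)) ∧
      (∀ f : ℤ[X], (fun _ => (1 : ℤ)) ⬝ᵥ wk A f = (fun _ => (1 : ℤ)) ⬝ᵥ wk B f) := by
  obtain ⟨hQ1, hQ2, hQ3⟩ := hQ
  have hQ1' : Q * Qᵀ = 1 := mul_eq_one_comm.1 hQ1
  let φ := Int.castRingHom ℚ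
  have hφ : (Int.cast : ℤ → ℚ) = φ := rfl
  have hinj : Function.Injective φ := Int.cast_injective
  let B : Matrix (Fin n) (Fin n) ℤ :=
    Matrix.of fun i j => if (Qᵀ * A.map (Int.cast : ℤ → ℚ) * Q) i j = 0 then 0 else 1
  have hB : B.map φ = Qᵀ * A.map φ * Q := by
    ext i j
    rw [← hφ]
    simp only [Matrix.map_apply, B, Matrix.of_apply]
    rcases hQ3 i j with h | h
    · simp [h]
    · rw [h]; simp
  have hQe : (Qᵀ *ᵥ fun _ => (1 : ℚ)) = fun _ => 1 := by
    conv_lhs => rw [← hQ2]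
    rw [Matrix.mulVec_mulVec, hQ1, Matrix.one_mulVec]
  have hae : ∀ f : ℚ[X], aeval (B.map φ) f = Qᵀ * aeval (A.map φ) f * Q := by
    intro f
    have hp : ∀ k : ℕ, (B.map φ) ^ k = Qᵀ * (A.map φ) ^ k * Q := by
      intro k
      induction k with
      | zero => simp [hQ1]
      | succ k ih =>
        rw [pow_succ, ih, hB, pow_succ]
        calc Qᵀ * A.map φ ^ k * Q * (Qᵀ * A.map φ * Q)
            = Qᵀ * A.map φ ^ k * (Q * Qᵀ) * (A.map φ * Q) := by simp only [Matrix.mul_assoc]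
          _ = _ := by rw [hQ1', Matrix.mul_one]; simp only [Matrix.mul_assoc]
    induction f using Polynomial.induction_on' with
    | add p q hp hq => simp [hp, hq, Matrix.mul_add, Matrix.add_mul]
    | monomial k a => simp [aeval_monomial, Algebra.algebraMap_eq_smul_one, hp]
  have hwk : ∀ f : ℤ[X], Qᵀ *ᵥ (fun i => ((wk A f i : ℤ) : ℚ)) = fun i => ((wk B f i : ℤ) : ℚ) := by
    intro f
    have h1 : (fun i => ((wk A f i : ℤ) : ℚ)) = wk (A.map φ) (f.map φ) := by rw [wk_map]; rfl
    have h2 : (fun i => ((wk B f i : ℤ) : ℚ)) = wk (B.map φ) (f.map φ) := by rw [wk_map]; rfl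
    rw [h1, h2]
    simp only [wk]
    rw [hae, ← Matrix.mulVec_mulVec, hQ2, ← Matrix.mulVec_mulVec]
  refine ⟨B, ?_, ?_, hwk, ?_⟩
  · apply Matrix.map_injective hinj
    show Bᵀ.map φ = B.map φ
    rw [Matrix.transpose_map, hB]
    simp only [Matrix.transpose_mul, Matrix.transpose_transpose, ← Matrix.transpose_map, hA,
      Matrix.mul_assoc]
  · apply Polynomial.map_injective φ hinj
    rw [← Matrix.charpoly_map, ← Matrix.charpoly_map, hB, Matrix.charpoly_mul_comm,
      ← Matrix.mul_assoc, hQ1', Matrix.one_mul]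
  · intro f
    apply hinj
    have h1 : ∀ w : Fin n → ℤ, φ ((fun _ => (1 : ℤ)) ⬝ᵥ w) = (fun _ => (1 : ℚ)) ⬝ᵥ (fun i => (w i : ℚ)) := by
      intro w; simp [dotProduct]
    rw [h1, h1, ← hwk, Matrix.dotProduct_mulVec, ← Matrix.mulVec_transpose,
      Matrix.transpose_transpose, hQ2]

lemma rank_mod (p : ℕ) [Fact p.Prime] (A : Matrix (Fin n) (Fin n) ℤ) (d : Fin n → ℤ)
    (h : IsSNF (walkMat A) d) :
    (wM (A.map (Int.castRingHom (ZMod p)))).rank =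
      (Finset.univ.filter fun i => ¬ (p : ℤ) ∣ d i).card := by
  obtain ⟨⟨U, V, hU, hV, hW⟩, -⟩ := h
  set φ := Int.castRingHom (ZMod p)
  rw [wM_map, ← walkMat_eq, hW, Matrix.map_mul, Matrix.map_mul]
  have hu : ∀ M : Matrix (Fin n) (Fin n) ℤ, IsUnimodular M → IsUnit (M.map φ).det := by
    intro M hM
    have := hM.map φ
    rwa [RingHom.map_det, RingHom.mapMatrix_apply] at this
  rw [Matrix.rank_mul_eq_left_of_isUnit_det _ _ (hu V hV),
    Matrix.rank_mul_eq_right_of_isUnit_det _ _ (hu U hU), Matrix.diagonal_map (map_zero φ),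
    Matrix.rank_diagonal, Fintype.card_subtype]
  congr 1
  ext i
  simp [φ, ZMod.intCast_zmod_eq_zero_iff_dvd]

lemma ker_odd (A B : Matrix (Fin n) (Fin n) ℤ) (hA : Aᵀ = A) (hB : Bᵀ = B) (hn : 0 < n)
    (p : ℕ) [Fact p.Prime] (hχ : A.charpoly = B.charpoly)
    (hτ : ∀ f : ℤ[X], (fun _ => (1 : ℤ)) ⬝ᵥ wk A f = (fun _ => (1 : ℤ)) ⬝ᵥ wk B f)
    (hr : (wM (A.map (Int.castRingHom (ZMod p)))).rank = n - 1)
    (f : (ZMod p)[X]) (hf : wk (A.map (Int.castRingHom (ZMod p))) f = 0) :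
    wk (B.map (Int.castRingHom (ZMod p))) f = 0 := by
  refine main_odd _ _ (by rw [← Matrix.transpose_map, hA]) (by rw [← Matrix.transpose_map, hB]) hn hr
    ?_ (by rw [Matrix.charpoly_map, Matrix.charpoly_map, hχ]) f hf
  intro g
  obtain ⟨g, rfl⟩ := Polynomial.map_surjective (Int.castRingHom (ZMod p))
    (ZMod.ringHom_surjective _) g
  rw [wk_map, wk_map]
  have h1 : ∀ w : Fin n → ℤ, (fun _ => (1 : ZMod p)) ⬝ᵥ ((Int.castRingHom (ZMod p)) ∘ w) =
      (Int.castRingHom (ZMod p)) ((fun _ => (1 : ℤ)) ⬝ᵥ w) := by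
    intro w; simp [dotProduct]
  rw [h1, h1, hτ]

end Glue

/-- Corollary 1: if the Smith normal form of `W(G)` is
`diag(1,…,1, 2^{l_1},…,2^{l_{n-r-1}}, 2^{l_{n-r}} p_1^{m_1} ⋯ p_s^{m_s})` with `r = ⌈n/2⌉` ones,
`l_i ≥ 1`, `m_i ≥ 1` and `p_1,…,p_s` distinct odd primes, then every `Q ∈ Q(G)` with level `ℓ`
satisfies `ℓ ∣ 2^{l_{n-r}-1} p_1^{m_1-1} ⋯ p_s^{m_s-1}`. -/
theorem stmt3 (n s : ℕ) (G : SimpleGraph (Fin n))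
    (r : ℕ) (hr : r = (n + 1) / 2) (hrn : r < n)
    (l : Fin (n - r) → ℕ) (hl : ∀ i, 1 ≤ l i)
    (pr : Fin s → ℕ) (hpr : ∀ j, (pr j).Prime) (hproddd : ∀ j, Odd (pr j))
    (hprinj : Function.Injective pr)
    (m : Fin s → ℕ) (hm : ∀ j, 1 ≤ m j)
    (d : Fin n → ℤ)
    (hd1 : ∀ i : Fin n, (i : ℕ) < r → d i = 1)
    (hd2 : ∀ i : Fin n, ∀ (h1 : r ≤ (i : ℕ)) (h2 : (i : ℕ) < n - 1),
      d i = 2 ^ (l ⟨(i : ℕ) - r, by omega⟩))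
    (hd3 : d ⟨n - 1, by omega⟩ =
      2 ^ (l ⟨n - r - 1, by omega⟩) * ∏ j, (pr j : ℤ) ^ (m j))
    (hSNF : IsSNF (walkMat (adjMat n G)) d)
    (Q : Matrix (Fin n) (Fin n) ℚ) (hQ : inQSet (adjMat n G) Q)
    (ℓ : ℕ) (hℓ : IsLevel Q ℓ) :
    (ℓ : ℤ) ∣ 2 ^ (l ⟨n - r - 1, by omega⟩ - 1) * ∏ j, (pr j : ℤ) ^ (m j - 1) := by
  obtain ⟨⟨U, V, hU, hV, hW⟩, hdd⟩ := id hSNF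
  set A := adjMat n G with hAdef
  have hA : Aᵀ = A := by
    ext i j
    simp [hAdef, adjMat, G.adj_comm]
  have hAd : ∀ i, A i i = 0 := by intro i; simp [hAdef, adjMat]
  obtain ⟨B, hB, hχ, hwk, hτ⟩ := exists_B A hA Q hQ
  have hn : 0 < n := by omega
  set last : Fin n := ⟨n - 1, by omega⟩ with hlast
  set L := l ⟨n - r - 1, by omega⟩ with hL
  have hL1 : 1 ≤ L := hl _
  have hdl : ∀ i, d i ∣ d last := fun i => hdd i last (by rw [Fin.le_def]; simp only [hlast]; omega)
  have hs := solve_snf (wM A) U V d hU hV (by rw [← walkMat_eq]; exact hW) (d last) hdl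
  have hgen : ∀ p : ℕ, p.Prime → (p : ℤ) ∣ d last →
      (∀ f : (ZMod p)[X], wk (A.map (Int.castRingHom (ZMod p))) f = 0 →
      wk (B.map (Int.castRingHom (ZMod p))) f = 0) → (p : ℤ) * ℓ ∣ d last := by
    rintro p hp ⟨t, ht⟩ hker
    rw [ht]
    apply mul_dvd_mul_left
    apply level_dvd Q ℓ hℓ
    rw [ht] at hs
    exact fun i j => step_prime A B Q hwk p hp t hs hker i j
  have hodd2 : ∀ j, ¬ (2 : ℤ) ∣ (pr j : ℤ) := by
    intro j h
    have := hproddd j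
    rw [← Nat.not_even_iff_odd] at this
    exact this (even_iff_two_dvd.2 (by exact_mod_cast h))
  have h2 : (2 : ℤ) * ℓ ∣ d last := by
    have : Fact (Nat.Prime 2) := ⟨Nat.prime_two⟩
    refine hgen 2 Nat.prime_two ?_ (main_two A B hA hB hAd hχ ?_)
    · rw [hd3]; exact dvd_mul_of_dvd_left (dvd_pow_self _ (by omega)) _
    · rw [rank_mod 2 A d hSNF]
      have : (Finset.univ.filter fun i : Fin n => ¬ ((2 : ℕ) : ℤ) ∣ d i) =
          Finset.univ.filter fun i : Fin n => (i : ℕ) < r := by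
        ext i
        simp only [Finset.mem_filter, Finset.mem_univ, true_and]
        constructor
        · intro h
          by_contra h3
          apply h
          by_cases h4 : (i : ℕ) < n - 1
          · rw [hd2 i (by omega) h4]
            exact dvd_pow_self _ (by have := hl ⟨(i : ℕ) - r, by omega⟩; omega)
          · have : i = last := by apply Fin.ext; simp only [hlast]; omega
            rw [this, hd3]; exact dvd_mul_of_dvd_left (dvd_pow_self _ (by omega)) _
        · intro h
          rw [hd1 i h]; norm_num
      rw [this, Fin.card_filter_val_lt, ← hr]
      omega
  have hp : ∀ j, (pr j : ℤ) * ℓ ∣ d last := by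
    intro j
    have : Fact (Nat.Prime (pr j)) := ⟨hpr j⟩
    have hdj : (pr j : ℤ) ∣ d last := by
      rw [hd3]
      exact dvd_mul_of_dvd_right ((dvd_pow_self _ (by have := hm j; omega)).trans
        (Finset.dvd_prod_of_mem (fun j => (pr j : ℤ) ^ m j) (Finset.mem_univ j))) _
    refine hgen (pr j) (hpr j) hdj (ker_odd A B hA hB hn (pr j) hχ hτ ?_)
    rw [rank_mod (pr j) A d hSNF]
    have : (Finset.univ.filter fun i : Fin n => ¬ ((pr j : ℕ) : ℤ) ∣ d i) =
        Finset.univ.erase last := by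
      ext i
      simp only [Finset.mem_filter, Finset.mem_univ, true_and, Finset.mem_erase, and_true]
      have hpz : Prime (pr j : ℤ) := Nat.prime_iff_prime_int.1 (hpr j)
      constructor
      · rintro h rfl; exact h hdj
      · intro h h3
        have h4 : (i : ℕ) < n - 1 := by
          have : (i : ℕ) ≠ n - 1 := fun h5 => h (Fin.ext h5)
          omega
        by_cases h5 : (i : ℕ) < r
        · rw [hd1 i h5] at h3
          exact hpz.not_dvd_one h3
        · rw [hd2 i (by omega) h4] at h3
          have h6 : pr j ∣ 2 := by exact_mod_cast hpz.dvd_of_dvd_pow h3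
          have h7 := (Nat.prime_dvd_prime_iff_eq (hpr j) Nat.prime_two).1 h6
          exact hodd2 j (by rw [h7]; norm_num)
    rw [this, Finset.card_erase_of_mem (Finset.mem_univ _), Finset.card_univ, Fintype.card_fin]
  -- combine
  have hℓ0 : (ℓ : ℤ) ≠ 0 := by exact_mod_cast hℓ.1.ne'
  obtain ⟨K, hK⟩ : (ℓ : ℤ) ∣ d last := (dvd_mul_left _ _).trans h2
  have h2K : (2 : ℤ) ∣ K := by
    rw [hK, mul_comm] at h2
    exact (mul_dvd_mul_iff_left hℓ0).1 h2
  have hpK : ∀ j, (pr j : ℤ) ∣ K := by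
    intro j
    have := hp j
    rw [hK, mul_comm] at this
    exact (mul_dvd_mul_iff_left hℓ0).1 this
  have hprodK : ∏ j, (pr j : ℤ) ∣ K := by
    apply Finset.prod_dvd_of_coprime
    · intro i _ j _ hij
      exact Nat.isCoprime_iff_coprime.2 ((Nat.coprime_primes (hpr i) (hpr j)).2 (hprinj.ne hij))
    · intro j _; exact hpK j
  have hcop : IsCoprime (2 : ℤ) (∏ j, (pr j : ℤ)) := by
    apply IsCoprime.prod_right
    intro j _
    exact (Int.prime_two.irreducible.coprime_iff_not_dvd).2 (hodd2 j)
  have hall := hcop.mul_dvd h2K hprodK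
  have hne : (2 * ∏ j, (pr j : ℤ)) ≠ 0 := by
    refine mul_ne_zero two_ne_zero (Finset.prod_ne_zero_iff.2 fun j _ => ?_)
    exact_mod_cast (hpr j).ne_zero
  have hfin : d last = (2 * ∏ j, (pr j : ℤ)) * (2 ^ (L - 1) * ∏ j, (pr j : ℤ) ^ (m j - 1)) := by
    have e1 : (2 : ℤ) ^ L = 2 * 2 ^ (L - 1) := by
      rw [← pow_succ']; congr 1; omega
    have e2 : ∏ j, (pr j : ℤ) ^ m j = (∏ j, (pr j : ℤ)) * ∏ j, (pr j : ℤ) ^ (m j - 1) := by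
      rw [← Finset.prod_mul_distrib]
      refine Finset.prod_congr rfl fun j _ => ?_
      rw [← pow_succ']; congr 1; have := hm j; omega
    rw [hd3, e1, e2]; ring
  have h9 : (2 * ∏ j, (pr j : ℤ)) * ℓ ∣ d last := by
    rw [hK, mul_comm]; exact mul_dvd_mul_left _ hall
  rw [hfin] at h9
  exact (mul_dvd_mul_iff_left hne).1 h9
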